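/- Let C be a contour with site set S, let F ⊆ interior(C) be a compact set whose boundary is the image of a Jordan curve γ (a continuous injective closed curve in ℝ²), and suppose every site of S lies in the interior of F. Let L be a planar contour labeling of (C,S) such that the leader of every label intersects the image of γ, and define the exit point of a label ℓ as the point of λ(ℓ) ∩ image(γ) closest to the port p(ℓ) along the leader. Then the ports of the labels induce the same cyclic radial ordering along ∂C (traversed clockwise) as the exit points of the corresponding labels induce along γ (traversed clockwise). -/

import Mathlib

open scoped Classical
noncomputable section

/-- Points of the Euclidean plane. -/
abbrev Pt : Type := ℝ × ℝ

/-- Cross product of `b - a` with `p - a`; its sign gives the orientation of `p`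
relative to the directed line from `a` to `b`. -/
def cross2 (a b p : Pt) : ℝ := (b.1 - a.1) * (p.2 - a.2) - (b.2 - a.2) * (p.1 - a.1)

/-- `p` lies strictly to the right of the directed line from `a` to `b`. -/
def StrictRightOf (a b p : Pt) : Prop := cross2 a b p < 0

/-- `p` lies strictly to the left of the directed line from `a` to `b`. -/
def StrictLeftOf (a b p : Pt) : Prop := 0 < cross2 a b p

/-- `p` lies on or to the left of the directed line from `a` to `b`. -/
def LeftOrOn (a b p : Pt) : Prop := 0 ≤ cross2 a b p

/-- The line through two points `a` and `b`. -/
def lineThrough (a b : Pt) : Set Pt := {p | cross2 a b p = 0}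

/-- The half-line emanating from `a` through `b`. -/
def halfLine (a b : Pt) : Set Pt := {p | ∃ t : ℝ, 0 ≤ t ∧ p = a + t • (b - a)}

/-- A contour: a compact convex subset of the plane with nonempty interior. -/
structure IsContour (C : Set Pt) : Prop where
  compact : IsCompact C
  convex : Convex ℝ C
  nonempty_interior : (interior C).Nonempty

/-- `t` is a topmost point of `C`. -/
def IsTopmost (C : Set Pt) (t : Pt) : Prop := t ∈ C ∧ ∀ q ∈ C, q.2 ≤ t.2

/-- The left chain of `C`: boundary points of minimal `x`-coordinate among the
points of `C` of the same `y`-coordinate. -/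
def leftChain (C : Set Pt) : Set Pt :=
  {p | p ∈ C ∧ p ∈ frontier C ∧ ∀ q ∈ C, q.2 = p.2 → p.1 ≤ q.1}

/-- The right chain of `C`: boundary points of maximal `x`-coordinate among the
points of `C` of the same `y`-coordinate. -/
def rightChain (C : Set Pt) : Set Pt :=
  {p | p ∈ C ∧ p ∈ frontier C ∧ ∀ q ∈ C, q.2 = p.2 → q.1 ≤ p.1}

/-- The sites are in general position: no three of them are collinear. -/
def GenPos (S : Finset Pt) : Prop :=
  ∀ a ∈ S, ∀ b ∈ S, ∀ c ∈ S, a ≠ b → b ≠ c → a ≠ c →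
    ¬ Collinear ℝ ({a, b, c} : Set Pt)

/-- A label: a site, an axis-parallel closed rectangular text box (given by its
lower-left corner `lo` and upper-right corner `hi`), a port, and an orientation
flag `isLeft` (`true` for a left label, `false` for a right label). -/
structure Label where
  site : Pt
  lo : Pt
  hi : Pt
  port : Pt
  isLeft : Bool

/-- The text box of a label, as a point set. -/
def Label.box (ℓ : Label) : Set Pt := Set.Icc ℓ.lo ℓ.hi

/-- The leader of a label: the closed segment from its site to its port. -/
def Label.leader (ℓ : Label) : Set Pt := segment ℝ ℓ.site ℓ.port

/-- A label as a point set: the union of its text box and its leader. -/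
def Label.toSet (ℓ : Label) : Set Pt := ℓ.box ∪ ℓ.leader

/-- A valid label with respect to a contour `C`: nondegenerate box whose interior
is disjoint from `C`, port on the boundary of `C` and on the right (resp. left)
edge of the text box for a left (resp. right) label (criterion T4), and leader
contained in `C`. -/
structure IsLabel (C : Set Pt) (ℓ : Label) : Prop where
  lo_le_hi : ℓ.lo ≤ ℓ.hi
  box_out : interior ℓ.box ∩ C = ∅
  port_bd : ℓ.port ∈ frontier C
  leader_in : ℓ.leader ⊆ C
  left_ok : ℓ.isLeft = true → ℓ.port.1 = ℓ.hi.1 ∧ ℓ.port.2 ∈ Set.Icc ℓ.lo.2 ℓ.hi.2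
  right_ok : ℓ.isLeft = false → ℓ.port.1 = ℓ.lo.1 ∧ ℓ.port.2 ∈ Set.Icc ℓ.lo.2 ℓ.hi.2

/-- The baseline of a label: the horizontal half-line emanating from the
bottom/top outer corner of the text box, away from the figure; a label is a top
label if the `y`-coordinate of its port is at least that of its site. -/
def Label.baseline (ℓ : Label) : Set Pt :=
  if ℓ.isLeft then
    (if ℓ.site.2 ≤ ℓ.port.2 then {p : Pt | p.2 = ℓ.hi.2 ∧ p.1 ≤ ℓ.lo.1}
     else {p : Pt | p.2 = ℓ.lo.2 ∧ p.1 ≤ ℓ.lo.1})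
  else
    (if ℓ.site.2 ≤ ℓ.port.2 then {p : Pt | p.2 = ℓ.hi.2 ∧ ℓ.hi.1 ≤ p.1}
     else {p : Pt | p.2 = ℓ.lo.2 ∧ ℓ.hi.1 ≤ p.1})

/-- Every left label has its port on the left chain and every right label has
its port on the right chain. -/
def PortsOnChains (C : Set Pt) (L : List Label) : Prop :=
  ∀ ℓ ∈ L, (ℓ.isLeft = true → ℓ.port ∈ leftChain C) ∧
           (ℓ.isLeft = false → ℓ.port ∈ rightChain C)

/-- `ChainPortOK C ℓ`: the port of `ℓ` lies on the chain matching its side. -/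
def ChainPortOK (C : Set Pt) (ℓ : Label) : Prop :=
  (ℓ.isLeft = true → ℓ.port ∈ leftChain C) ∧ (ℓ.isLeft = false → ℓ.port ∈ rightChain C)

/-- Clockwise order (from the topmost point) of two boundary points of `C` that
lie on its chains: the right chain is traversed top-down before the left chain
is traversed bottom-up. -/
def CwLT (C : Set Pt) (p q : Pt) : Prop :=
  (p ∈ rightChain C ∧ q ∈ rightChain C ∧ q.2 < p.2) ∨
  (p ∈ rightChain C ∧ q ∈ leftChain C ∧ q ∉ rightChain C) ∨
  (p ∉ rightChain C ∧ p ∈ leftChain C ∧ q ∈ leftChain C ∧ q ∉ rightChain C ∧ p.2 < q.2)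

/-- A list of labels is in radial order if consecutive list entries have ports in
clockwise order along the boundary of `C`. -/
def InRadialOrder (C : Set Pt) (L : List Label) : Prop :=
  L.Chain' (fun a b => CwLT C a.port b.port)

/-- A contour labeling of `(C, S)`, represented as the list of its labels in
radial order: exactly one valid label for each site of `S`. -/
structure IsContourLabeling (C : Set Pt) (S : Finset Pt) (L : List Label) : Prop where
  valid : ∀ ℓ ∈ L, IsLabel C ℓ
  nodup_sites : (L.map Label.site).Nodup
  sites_iff : ∀ s : Pt, s ∈ S ↔ s ∈ L.map Label.site
  radial : InRadialOrder C L

/-- A labeling is planar if its labels are pairwise disjoint point sets. -/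
def PlanarList (L : List Label) : Prop :=
  L.Pairwise (fun a b => a.toSet ∩ b.toSet = ∅)

/-- Two labels are consecutive in the cyclic radial ordering. -/
def Consecutive (L : List Label) (a b : Label) : Prop :=
  (a, b) ∈ L.zip (L.rotate 1) ∨ (b, a) ∈ L.zip (L.rotate 1)

/-- Staircase property (criterion T5): no label intersects the baseline of a
consecutive label. -/
def IsStaircase (L : List Label) : Prop :=
  ∀ a b, Consecutive L a b → a.toSet ∩ b.baseline = ∅ ∧ b.toSet ∩ a.baseline = ∅

/-- Assumption 1: no text box of any label intersects the convex hull of the sites. -/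
def Assumption1 (S : Finset Pt) (L : List Label) : Prop :=
  ∀ ℓ ∈ L, ℓ.box ∩ convexHull ℝ (S : Set Pt) = ∅

/-- No two leaders of the labeling intersect. -/
def LeadersDisjoint (L : List Label) : Prop :=
  L.Pairwise (fun a b => a.leader ∩ b.leader = ∅)

/-- No two consecutive labels of the labeling intersect. -/
def ConsecutiveDisjoint (L : List Label) : Prop :=
  ∀ a b, Consecutive L a b → a ≠ b → a.toSet ∩ b.toSet = ∅

/-- The (open) path cost of a list of labels:
`Σ c1(ℓ_i) + Σ c2(ℓ_i, ℓ_{i+1})` over consecutive pairs of the list. -/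
def pathCost (c1 : Label → ℝ) (c2 : Label → Label → ℝ) (L : List Label) : ℝ :=
  (L.map c1).sum + (List.zipWith c2 L L.tail).sum

/-- The cyclic cost of a labeling:
`Σ_{i=1}^n ( c1(ℓ_i) + c2(ℓ_i, ℓ_{i+1}) )` with `ℓ_{n+1} = ℓ_1`. -/
def cycCost (c1 : Label → ℝ) (c2 : Label → Label → ℝ) (L : List Label) : ℝ :=
  (L.map c1).sum + (List.zipWith c2 L (L.rotate 1)).sum

/-- The polyline through a list of points, as a point set. -/
def polyline : List Pt → Set Pt
  | [] => ∅
  | [a] => {a}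
  | a :: b :: r => segment ℝ a b ∪ polyline (b :: r)

/-- A convex chain `(s_1, …, s_k)`: at least two pairwise distinct points that
appear in this order on the boundary of their convex hull (the hull lies to the
left of each directed edge), the interior points lying strictly to the right of
the directed line from `s_1` to `s_k`. -/
def IsConvexChain (K : List Pt) : Prop :=
  2 ≤ K.length ∧ K.Nodup ∧
  (∀ ab ∈ K.zip K.tail, ∀ p ∈ K, LeftOrOn ab.1 ab.2 p) ∧
  (∀ p ∈ K, LeftOrOn K.getLast! K.head! p) ∧
  (∀ s ∈ (K.drop 1).dropLast, StrictRightOf K.head! K.getLast! s)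

/-- A (candidate) sub-instance, given by its separator: the two fixed labels
`la` and `lb` and the convex chain `K` from the site of `la` to the site of `lb`. -/
structure SubInstance where
  la : Label
  lb : Label
  K : List Pt

namespace SubInstance

/-- The separator `K' = (p_1, s_1, …, s_k, p_k)` as a point set. -/
def sepSet (J : SubInstance) : Set Pt :=
  J.la.leader ∪ polyline J.K ∪ J.lb.leader

/-- The interior sites `s_2, …, s_{k-1}` of the chain of the separator. -/
def innerSites (J : SubInstance) : Set Pt := {p | p ∈ (J.K.drop 1).dropLast}

/-- The region `C'` of the sub-instance: the part of `C` cut off by the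
separator that does not contain the topmost point `t`. -/
def region (C : Set Pt) (t : Pt) (J : SubInstance) : Set Pt :=
  C \ connectedComponentIn (C \ J.sepSet) t

/-- The region `C''`: the closed part of `C` on the side of the separator that
contains the topmost point `t` (the concave counterpart). -/
def regionTop (C : Set Pt) (t : Pt) (J : SubInstance) : Set Pt :=
  C ∩ closure (connectedComponentIn (C \ J.sepSet) t)

/-- The sites belonging to the sub-instance: the sites of `S` in its region,
other than the sites of the two separator labels. -/
def sites (C : Set Pt) (t : Pt) (S : Finset Pt) (J : SubInstance) : Set Pt :=
  {s | s ∈ (S : Set Pt) ∧ s ∈ J.region C t ∧ s ≠ J.la.site ∧ s ≠ J.lb.site}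

/-- Region `A_1` of the concave part `C''`: the part of `C''` strictly to the
left of the line from `s_1` to `s_k` that is adjacent to the leader of `la`. -/
def A1 (C : Set Pt) (t : Pt) (J : SubInstance) : Set Pt :=
  {p | p ∈ J.regionTop C t ∧ StrictLeftOf J.la.site J.lb.site p ∧
    (closure (connectedComponentIn
        (J.regionTop C t ∩ {q | StrictLeftOf J.la.site J.lb.site q}) p)
      ∩ J.la.leader).Nonempty}

/-- Region `A_3` of the concave part `C''`: the part of `C''` strictly to the
left of the line from `s_1` to `s_k` that is adjacent to the leader of `lb`. -/
def A3 (C : Set Pt) (t : Pt) (J : SubInstance) : Set Pt :=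
  {p | p ∈ J.regionTop C t ∧ StrictLeftOf J.la.site J.lb.site p ∧
    (closure (connectedComponentIn
        (J.regionTop C t ∩ {q | StrictLeftOf J.la.site J.lb.site q}) p)
      ∩ J.lb.leader).Nonempty}

/-- Region `A_2` of the concave part `C''`: the part strictly to the right of
the line from `s_1` to `s_k`. -/
def A2 (C : Set Pt) (t : Pt) (J : SubInstance) : Set Pt :=
  {p | p ∈ J.regionTop C t ∧ StrictRightOf J.la.site J.lb.site p}

/-- For a capstone instance: the part `A_1` of the region of the instance
strictly to the right of the line from `s_1` to `s_2`, adjacent to the leader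
of `la`. -/
def A1cap (C : Set Pt) (t : Pt) (J : SubInstance) : Set Pt :=
  {p | p ∈ J.region C t ∧ StrictRightOf J.la.site J.lb.site p ∧
    (closure (connectedComponentIn
        (J.region C t ∩ {q | StrictRightOf J.la.site J.lb.site q}) p)
      ∩ J.la.leader).Nonempty}

/-- For a capstone instance: the part `A_3` of the region of the instance
strictly to the right of the line from `s_1` to `s_2`, adjacent to the leader
of `lb`. -/
def A3cap (C : Set Pt) (t : Pt) (J : SubInstance) : Set Pt :=
  {p | p ∈ J.region C t ∧ StrictRightOf J.la.site J.lb.site p ∧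
    (closure (connectedComponentIn
        (J.region C t ∩ {q | StrictRightOf J.la.site J.lb.site q}) p)
      ∩ J.lb.leader).Nonempty}

/-- For a capstone instance: the part `A_2` of the region of the instance
strictly to the left of the line from `s_1` to `s_2`. -/
def A2cap (C : Set Pt) (t : Pt) (J : SubInstance) : Set Pt :=
  {p | p ∈ J.region C t ∧ StrictLeftOf J.la.site J.lb.site p}

end SubInstance

/-- Well-formedness of a separator: the two labels are valid, satisfy T4 with
ports on the correct chains, are disjoint, the chain is convex and runs from the
site of `la` to the site of `lb`, and the port of `la` is met before the port
of `lb` when traversing the boundary clockwise from the topmost point. -/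
structure IsSeparator (C : Set Pt) (t : Pt) (J : SubInstance) : Prop where
  la_valid : IsLabel C J.la
  lb_valid : IsLabel C J.lb
  la_chain : ChainPortOK C J.la
  lb_chain : ChainPortOK C J.lb
  disj : J.la.toSet ∩ J.lb.toSet = ∅
  chain : IsConvexChain J.K
  head_eq : J.K.head? = some J.la.site
  last_eq : J.K.getLast? = some J.lb.site
  order : CwLT C J.la.port J.lb.port

/-- A label is contained in a sub-instance if its leader lies in the region of
the sub-instance and meets the separator at most in the interior chain sites,
and its port lies on the part of the boundary of `C` belonging to the
sub-instance. -/
def ContainedIn (C : Set Pt) (t : Pt) (J : SubInstance) (ℓ : Label) : Prop :=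
  ℓ.leader ⊆ J.region C t ∧
  ℓ.leader ∩ J.sepSet ⊆ J.innerSites ∧
  ℓ.port ∈ frontier C ∧ ℓ.port ∈ J.region C t

/-- The restriction `L|J` of a radially ordered labeling `L` to a sub-instance
`J`: the labels of `L` contained in `J`, together with the two separator labels
of `J`, in radial order. -/
def restrict (C : Set Pt) (t : Pt) (L : List Label) (J : SubInstance) : List Label :=
  J.la :: (L.filter (fun ℓ => decide (ContainedIn C t J ℓ)) ++ [J.lb])

/-- A planar labeling of a convex instance `J`: the two fixed separator labels
(first and last in radial order) together with exactly one label for each site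
of the instance, pairwise disjoint, each contained in the instance. -/
structure IsInstanceLabeling (C : Set Pt) (t : Pt) (S : Finset Pt)
    (J : SubInstance) (L : List Label) : Prop where
  sep : IsSeparator C t J
  head_eq : L.head? = some J.la
  last_eq : L.getLast? = some J.lb
  valid : ∀ ℓ ∈ L, IsLabel C ℓ
  contained : ∀ ℓ ∈ L, ℓ ≠ J.la → ℓ ≠ J.lb → ContainedIn C t J ℓ
  nodup_sites : (L.map Label.site).Nodup
  sites_iff : ∀ s : Pt, s ∈ J.sites C t S ↔ ∃ ℓ ∈ L, ℓ ≠ J.la ∧ ℓ ≠ J.lb ∧ ℓ.site = s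
  planar : PlanarList L
  radial : InRadialOrder C L

/-- `W` separates `A` from `B` inside the ambient set `amb`: no connected subset
of `amb \ W` meets both `A` and `B`. -/
def SeparatesIn (amb W A B : Set Pt) : Prop :=
  ∀ a ∈ A \ W, ∀ b ∈ B \ W, b ∉ connectedComponentIn (amb \ W) a

/-- The convex instance `J` has type A with support point `s`: `s` is a site in
region `A_1` such that the label `la` together with the half-line emanating from
`s` through the site of `la` separates the chain `K` from the sites in the
concave part `C''`. -/
def IsTypeA (C : Set Pt) (t : Pt) (S : Finset Pt) (J : SubInstance) (s : Pt) : Prop :=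
  s ∈ (S : Set Pt) ∧ s ∈ J.A1 C t ∧
  SeparatesIn C (J.la.toSet ∪ halfLine s J.la.site)
    {p | p ∈ J.K} ((S : Set Pt) ∩ J.regionTop C t)

/-- The convex instance `J` has type B with support point `s`: `s` is a site in
region `A_3` such that the label `lb` together with the half-line emanating from
`s` through the site of `lb` separates the chain `K` from the sites in the
concave part `C''`. -/
def IsTypeB (C : Set Pt) (t : Pt) (S : Finset Pt) (J : SubInstance) (s : Pt) : Prop :=
  s ∈ (S : Set Pt) ∧ s ∈ J.A3 C t ∧
  SeparatesIn C (J.lb.toSet ∪ halfLine s J.lb.site)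
    {p | p ∈ J.K} ((S : Set Pt) ∩ J.regionTop C t)

/-- The concave part `C''` of the instance contains no sites (besides the chain
sites themselves); this is the case of support point `⊥`. -/
def ConcaveEmpty (C : Set Pt) (t : Pt) (S : Finset Pt) (J : SubInstance) : Prop :=
  (S : Set Pt) ∩ J.regionTop C t ⊆ {p | p ∈ J.K}

/-- A capstone instance: the chain consists only of the two separator sites. -/
def IsCapstone (J : SubInstance) : Prop :=
  J.K = [J.la.site, J.lb.site]

/-- Two sub-instances are disjoint if the interiors of their regions are disjoint. -/
def InstancesDisjoint (C : Set Pt) (t : Pt) (J J' : SubInstance) : Prop :=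
  interior (J.region C t) ∩ interior (J'.region C t) = ∅

end

/-- A clockwise parametrization of a Jordan curve around the point `z`: the
angle of `γ s - z` admits a continuous lift that decreases by `2π` per period. -/
def ClockwiseJordan (γ : ℝ → Pt) (z : Pt) : Prop :=
  ∃ ρ θ : ℝ → ℝ, Continuous ρ ∧ Continuous θ ∧ (∀ s, 0 < ρ s) ∧
    (∀ s, γ s - z = (ρ s * Real.cos (θ s), ρ s * Real.sin (θ s))) ∧
    ∀ s, θ (s + 1) = θ s - 2 * Real.pi

lemma o6_lift {X : Type} [TopologicalSpace X] [SimplyConnectedSpace X]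
    [LocallyPathConnectedSpace X] (f : X → ℂ) (hf : Continuous f) (h0 : ∀ x, f x ≠ 0)
    (a₀ : X) (e₀ : ℂ) (he : Complex.exp e₀ = f a₀) :
    ∃ G : X → ℂ, Continuous G ∧ G a₀ = e₀ ∧ ∀ x, Complex.exp (G x) = f x := by
  obtain ⟨G, ⟨h1, h2⟩, -⟩ := Complex.isCoveringMapOn_exp.existsUnique_continuousMap_lifts
    (⟨f, hf⟩ : C(X, ℂ)) (a₀ := a₀) (e₀ := e₀) he (fun a => by simpa using h0 a)
  exact ⟨G, G.continuous, h1, fun x => congrFun h2 x⟩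

lemma o6_path (q : ℝ → Pt) (hq : Continuous q) (h0 : ∀ x, q x ≠ 0) (ρ θ : ℝ) (hρ : 0 < ρ)
    (hq0 : q 0 = (ρ * Real.cos θ, ρ * Real.sin θ)) :
    ∃ x r : ℝ → ℝ, Continuous x ∧ Continuous r ∧ (∀ s, 0 < r s) ∧ x 0 = θ ∧ r 0 = ρ ∧
      ∀ s, q s = (r s * Real.cos (x s), r s * Real.sin (x s)) := by
  obtain ⟨G, hG, hG0, hGe⟩ := o6_lift (fun s => (⟨(q s).1, (q s).2⟩ : ℂ))
    (by
      have : (fun s => (⟨(q s).1, (q s).2⟩ : ℂ)) = fun s => Complex.equivRealProdCLM.symm (q s) := by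
        funext s; rfl
      rw [this]; fun_prop)
    (fun s h => h0 s (by
      have h1 := congrArg Complex.re h
      have h2 := congrArg Complex.im h
      exact Prod.ext h1 h2)) 0 ⟨Real.log ρ, θ⟩ (by
      apply Complex.ext
      · simp [Complex.exp_re, Real.exp_log hρ, hq0]
      · simp [Complex.exp_im, Real.exp_log hρ, hq0])
  refine ⟨fun s => (G s).im, fun s => Real.exp (G s).re, by fun_prop, by fun_prop,
    fun s => Real.exp_pos _, by simp [hG0], by simp [hG0, Real.exp_log hρ], fun s => ?_⟩
  have h1 := congrArg Complex.re (hGe s)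
  have h2 := congrArg Complex.im (hGe s)
  rw [Complex.exp_re] at h1
  rw [Complex.exp_im] at h2
  exact Prod.ext h1.symm h2.symm

lemma o6_ivt_lt (f : ℝ → ℝ) (hf : Continuous f) (c x₀ : ℝ) (hc : ∀ x, f x ≠ c) (h : f x₀ < c)
    (x : ℝ) : f x < c := by
  by_contra! hx
  obtain ⟨y, hy⟩ := mem_range_of_exists_le_of_exists_ge hf ⟨x₀, h.le⟩ ⟨x, hx⟩
  exact hc y hy

lemma o6_ivt_gt (f : ℝ → ℝ) (hf : Continuous f) (c x₀ : ℝ) (hc : ∀ x, f x ≠ c) (h : c < f x₀)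
    (x : ℝ) : c < f x := by
  by_contra! hx
  obtain ⟨y, hy⟩ := mem_range_of_exists_le_of_exists_ge hf ⟨x, hx⟩ ⟨x₀, h.le⟩
  exact hc y hy

/-- Crossing lemma. -/
lemma o6_cross (xA rA xB rB : ℝ → ℝ) (hxA : Continuous xA) (hrA : Continuous rA)
    (hxB : Continuous xB) (hrB : Continuous rB)
    (hne : ∀ s t, xA s = xB t → rA s = rB t → False) (S0 T0 S1 T1 : ℝ)
    (hS0 : ∀ t, xB t < xA S0) (hT0 : ∀ s, xB T0 < xA s)
    (hS1 : ∀ t, xA S1 = xB t → rB t ≤ rA S1) (hT1 : ∀ s, xA s = xB T1 → rA s ≤ rB T1) :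
    xB T1 < xA S1 := by
  by_contra! hle
  have hlt : xA S1 < xB T1 := by
    rcases hle.lt_or_eq with h | h
    · exact h
    · exact (hne _ _ h (le_antisymm (hT1 _ h) (hS1 _ h))).elim
  have hcont : Continuous (fun st : ℝ × ℝ => (⟨xA st.1 - xB st.2, rA st.1 - rB st.2⟩ : ℂ)) := by
    have : (fun st : ℝ × ℝ => (⟨xA st.1 - xB st.2, rA st.1 - rB st.2⟩ : ℂ)) =
      fun st => Complex.equivRealProdCLM.symm (xA st.1 - xB st.2, rA st.1 - rB st.2) := by
        funext s; rfl
    rw [this]; fun_prop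
  have hpos : 0 < xA S0 - xB T0 := sub_pos.2 (hS0 T0)
  have hn0 : ∀ st : ℝ × ℝ, (⟨xA st.1 - xB st.2, rA st.1 - rB st.2⟩ : ℂ) ≠ 0 := by
    intro st h
    have h1 := congrArg Complex.re h
    have h2 := congrArg Complex.im h
    simp only [Complex.zero_re, Complex.zero_im] at h1 h2
    exact hne st.1 st.2 (by linarith) (by linarith)
  obtain ⟨G, hG, hG0, hGe⟩ := o6_lift _ hcont hn0 (S0, T0) (Complex.log ⟨xA S0 - xB T0, rA S0 - rB T0⟩)
    (Complex.exp_log (hn0 (S0, T0)))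
  have hre : ∀ s t, Real.exp (G (s, t)).re * Real.cos (G (s, t)).im = xA s - xB t := by
    intro s t
    have h1 := congrArg Complex.re (hGe (s, t))
    rwa [Complex.exp_re] at h1
  have him : ∀ s t, Real.exp (G (s, t)).re * Real.sin (G (s, t)).im = rA s - rB t := by
    intro s t
    have h1 := congrArg Complex.im (hGe (s, t))
    rwa [Complex.exp_im] at h1
  set a : ℝ → ℝ → ℝ := fun s t => (G (s, t)).im with ha
  have ha0 : |a S0 T0| < Real.pi / 2 := by
    simp only [ha, hG0, Complex.log_im]
    exact Complex.abs_arg_lt_pi_div_two_iff.2 (Or.inl hpos)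
  obtain ⟨ha1, ha2⟩ := abs_lt.1 ha0
  have hac1 : ∀ s, Continuous (fun t => a s t) := fun s => by simp only [ha]; fun_prop
  have hac2 : ∀ t, Continuous (fun s => a s t) := fun t => by simp only [ha]; fun_prop
  have hcos : ∀ s t, Real.cos (a s t) = 0 → xA s = xB t := by
    intro s t h
    have := hre s t
    rw [show Real.cos (G (s, t)).im = 0 from h] at this
    linarith
  have hp2 : Real.cos (Real.pi / 2) = 0 := Real.cos_pi_div_two
  have hm2 : Real.cos (-(Real.pi / 2)) = 0 := by rw [Real.cos_neg, hp2]
  -- edge S0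
  have b1 := o6_ivt_lt _ (hac1 S0) (Real.pi / 2) T0
    (fun t h => (hS0 t).ne' (hcos S0 t (by rw [h, hp2]))) ha2 T1
  -- edge T0
  have b2 := o6_ivt_gt _ (hac2 T0) (-(Real.pi / 2)) S0
    (fun s h => (hT0 s).ne' (hcos s T0 (by rw [h, hm2]))) ha1 S1
  -- edge T1
  have b3 := o6_ivt_lt _ (hac2 T1) (Real.pi / 2) S0
    (fun s h => by
      have e1 := hcos s T1 (by rw [h, hp2])
      have e2 := him s T1
      rw [show (G (s, T1)).im = Real.pi / 2 from h, Real.sin_pi_div_two] at e2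
      have := Real.exp_pos (G (s, T1)).re
      have := hT1 s e1
      linarith) b1 S1
  -- edge S1
  have b4 := o6_ivt_gt _ (hac1 S1) (-(Real.pi / 2)) T0
    (fun t h => by
      have e1 := hcos S1 t (by rw [h, hm2])
      have e2 := him S1 t
      rw [show (G (S1, t)).im = -(Real.pi / 2) from h, Real.sin_neg, Real.sin_pi_div_two] at e2
      have := Real.exp_pos (G (S1, t)).re
      have := hS1 t e1
      linarith) b2 T1
  have c1 := Real.cos_pos_of_mem_Ioo ⟨b4, b3⟩
  have c2 := mul_pos (Real.exp_pos (G (S1, T1)).re) c1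
  have c3 := hre S1 T1
  simp only [ha] at c2
  linarith

lemma o6_star (C : Set Pt) (hC : Convex ℝ C) (z p Q : Pt) (hz : z ∈ interior C)
    (hp : p ∈ frontier C) (hQ : Q ∈ C) (x r r' : ℝ) (hr : 0 < r) (hr' : 0 < r')
    (h1 : p - z = (r * Real.cos x, r * Real.sin x))
    (h2 : Q - z = (r' * Real.cos x, r' * Real.sin x)) : r' ≤ r := by
  by_contra! hlt
  have h : Q + (1 - r / r') • (z - Q) ∈ interior C :=
    hC.add_smul_sub_mem_interior hQ hz
      ⟨by rw [sub_pos, div_lt_one hr']; exact hlt, by have := div_pos hr hr'; linarith⟩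
  have e : Q + (1 - r / r') • (z - Q) = p := by
    have h11 := congrArg Prod.fst h1
    have h12 := congrArg Prod.snd h1
    have h21 := congrArg Prod.fst h2
    have h22 := congrArg Prod.snd h2
    simp only [Prod.fst_sub, Prod.snd_sub] at h11 h12 h21 h22
    apply Prod.ext
    · simp only [Prod.fst_add, Prod.smul_fst, Prod.fst_sub, smul_eq_mul]
      rw [show z.1 - Q.1 = -(r' * Real.cos x) by linarith,
        show Q.1 = z.1 + r' * Real.cos x by linarith, show p.1 = z.1 + r * Real.cos x by linarith]
      field_simp; ring
    · simp only [Prod.snd_add, Prod.smul_snd, Prod.snd_sub, smul_eq_mul]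
      rw [show z.2 - Q.2 = -(r' * Real.sin x) by linarith,
        show Q.2 = z.2 + r' * Real.sin x by linarith, show p.2 = z.2 + r * Real.sin x by linarith]
      field_simp; ring
  rw [e] at h
  exact hp.2 h

/-- A lifted arm from the curve to the boundary of the contour. -/
structure O6Arm (C : Set Pt) (γ : ℝ → Pt) (z : Pt) (ρ θ : ℝ → ℝ) (v : ℝ) (x r : ℝ → ℝ)
    (σ : ℝ → Pt) : Prop where
  cx : Continuous x
  cr : Continuous r
  rpos : ∀ t, 0 < r t
  x0 : x 0 = θ v
  r0 : r 0 = ρ v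
  mem : ∀ t, σ t ∈ C
  pol : ∀ t, σ t - z = (r t * Real.cos (x t), r t * Real.sin (x t))
  out : ∀ t, 0 < t → σ t ∉ Set.range γ
  fr : σ 1 ∈ frontier C
  bdd : ∃ M, ∀ t, |x t| ≤ M

lemma O6Arm.shift {C : Set Pt} {γ : ℝ → Pt} {z : Pt} {ρ θ : ℝ → ℝ} {v : ℝ} {x r : ℝ → ℝ}
    {σ : ℝ → Pt} (h : O6Arm C γ z ρ θ v x r σ) (hθ : ∀ s, θ (s + 1) = θ s - 2 * Real.pi)
    (hρ : ∀ s, ρ (s + 1) = ρ s) :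
    O6Arm C γ z ρ θ (v + 1) (fun t => x t - 2 * Real.pi) r σ where
  cx := h.cx.sub continuous_const
  cr := h.cr
  rpos := h.rpos
  x0 := by simp [hθ, h.x0]
  r0 := by simp [hρ, h.r0]
  mem := h.mem
  pol := by simpa using h.pol
  out := h.out
  fr := h.fr
  bdd := by
    obtain ⟨M, hM⟩ := h.bdd
    refine ⟨M + 2 * Real.pi, fun t => ?_⟩
    have h1 := hM t
    have h2 := Real.pi_pos
    rw [abs_le] at h1 ⊢
    constructor <;> linarith [h1.1, h1.2]

lemma o6_polar_inj {r r' x : ℝ}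
    (h : ((r * Real.cos x, r * Real.sin x) : Pt) = (r' * Real.cos x, r' * Real.sin x)) : r = r' := by
  have h1 := congrArg Prod.fst h
  have h2 := congrArg Prod.snd h
  simp only at h1 h2
  have h3 := Real.sin_sq_add_cos_sq x
  have : (r - r') * (Real.sin x ^ 2 + Real.cos x ^ 2) = 0 := by
    linear_combination Real.cos x * h1 + Real.sin x * h2
  rw [h3] at this
  linarith

lemma o6_key {C : Set Pt} {γ : ℝ → Pt} {z : Pt} {ρ θ : ℝ → ℝ} {v w : ℝ} {x r x' r' : ℝ → ℝ}
    {σ τ : ℝ → Pt} (hC : Convex ℝ C) (hz : z ∈ interior C)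
    (hγper : Function.Periodic γ 1) (hγinj : Set.InjOn γ (Set.Ico (0 : ℝ) 1))
    (hγC : ∀ s, γ s ∈ C)
    (hρc : Continuous ρ) (hθc : Continuous θ) (hρ : ∀ s, 0 < ρ s)
    (hpol : ∀ s, γ s - z = (ρ s * Real.cos (θ s), ρ s * Real.sin (θ s)))
    (hθ : ∀ s, θ (s + 1) = θ s - 2 * Real.pi)
    (h1 : O6Arm C γ z ρ θ v x r σ) (h2 : O6Arm C γ z ρ θ w x' r' τ)
    (hdis : ∀ s t, σ s ≠ τ t) (hvw : v < w) : x' 1 < x 1 := by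
  have hper : Function.Periodic (fun s => θ s + 2 * Real.pi * s) 1 := by
    intro s; simp only [hθ]; ring
  have hpi := Real.pi_gt_three
  obtain ⟨M, hM⟩ : ∃ M, ∀ s, |θ s + 2 * Real.pi * s| ≤ M := by
    obtain ⟨M, hM⟩ := (isCompact_Icc (a := (0 : ℝ)) (b := 1)).exists_bound_of_continuousOn
      (f := fun s => θ s + 2 * Real.pi * s) (by fun_prop)
    refine ⟨M, fun s => ?_⟩
    have e := hper.sub_int_mul_eq ⌊s⌋ (x := s)
    have e2 := hM (Int.fract s) ⟨Int.fract_nonneg _, (Int.fract_lt_one _).le⟩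
    rw [Int.fract] at e2
    simp only [mul_one] at e
    rw [e] at e2
    exact e2
  obtain ⟨M1, hM1⟩ := h1.bdd
  obtain ⟨M2, hM2⟩ := h2.bdd
  simp only [abs_le] at hM hM1 hM2
  set xA : ℝ → ℝ := fun s => θ (min s v) + x (max (s - v) 0) - θ v with hxA
  set rA : ℝ → ℝ := fun s => ρ (min s v) + r (max (s - v) 0) - ρ v with hrA
  set xB : ℝ → ℝ := fun t => θ (max t w) + x' (max (w - t) 0) - θ w with hxB
  set rB : ℝ → ℝ := fun t => ρ (max t w) + r' (max (w - t) 0) - ρ w with hrB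
  have a1 : ∀ s, s ≤ v → xA s = θ s ∧ rA s = ρ s := by
    intro s hs
    simp [hxA, hrA, min_eq_left hs, max_eq_right (sub_nonpos.2 hs), h1.x0, h1.r0]
  have a2 : ∀ s, v ≤ s → xA s = x (s - v) ∧ rA s = r (s - v) := by
    intro s hs
    simp [hxA, hrA, min_eq_right hs, max_eq_left (sub_nonneg.2 hs)]
  have b1 : ∀ s, w ≤ s → xB s = θ s ∧ rB s = ρ s := by
    intro s hs
    simp [hxB, hrB, max_eq_left hs, max_eq_right (sub_nonpos.2 hs), h2.x0, h2.r0]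
  have b2 : ∀ s, s ≤ w → xB s = x' (w - s) ∧ rB s = r' (w - s) := by
    intro s hs
    simp [hxB, hrB, max_eq_right hs, max_eq_left (sub_nonneg.2 hs)]
  have S : ∀ s, 0 < rA s ∧ ∃ P ∈ C, P - z = (rA s * Real.cos (xA s), rA s * Real.sin (xA s)) := by
    intro s
    rcases le_total s v with hs | hs
    · rw [(a1 s hs).1, (a1 s hs).2]; exact ⟨hρ s, γ s, hγC s, hpol s⟩
    · rw [(a2 s hs).1, (a2 s hs).2]; exact ⟨h1.rpos _, _, h1.mem _, h1.pol _⟩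
  have T : ∀ s, 0 < rB s ∧ ∃ P ∈ C, P - z = (rB s * Real.cos (xB s), rB s * Real.sin (xB s)) := by
    intro s
    rcases le_total w s with hs | hs
    · rw [(b1 s hs).1, (b1 s hs).2]; exact ⟨hρ s, γ s, hγC s, hpol s⟩
    · rw [(b2 s hs).1, (b2 s hs).2]; exact ⟨h2.rpos _, _, h2.mem _, h2.pol _⟩
  have sA : xA (v + 1) = x 1 ∧ rA (v + 1) = r 1 := by
    have := a2 (v + 1) (by linarith)
    simpa using this
  have sB : xB (w - 1) = x' 1 ∧ rB (w - 1) = r' 1 := by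
    have := b2 (w - 1) (by linarith)
    simpa using this
  have xAlow : ∃ K, ∀ s, K < xA s := by
    refine ⟨min (-M - 2 * Real.pi * v) (-M1) - 1, fun s => ?_⟩
    rcases le_total s v with hs | hs
    · rw [(a1 s hs).1]
      have := (hM s).1
      have := min_le_left (-M - 2 * Real.pi * v) (-M1)
      nlinarith
    · rw [(a2 s hs).1]
      have := (hM1 (s - v)).1
      have := min_le_right (-M - 2 * Real.pi * v) (-M1)
      linarith
  have xBup : ∃ K, ∀ s, xB s < K := by
    refine ⟨max (M - 2 * Real.pi * w) M2 + 1, fun s => ?_⟩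
    rcases le_total w s with hs | hs
    · rw [(b1 s hs).1]
      have := (hM s).2
      have := le_max_left (M - 2 * Real.pi * w) M2
      nlinarith
    · rw [(b2 s hs).1]
      have := (hM2 (w - s)).2
      have := le_max_right (M - 2 * Real.pi * w) M2
      linarith
  obtain ⟨K1, hK1⟩ := xAlow
  obtain ⟨K2, hK2⟩ := xBup
  have hS0 : ∃ S0, K2 ≤ xA S0 := by
    refine ⟨min v (-(|M| + |K2|)), ?_⟩
    rw [(a1 _ (min_le_left _ _)).1]
    have := (hM (min v (-(|M| + |K2|)))).1
    have := min_le_right v (-(|M| + |K2|))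
    have := le_abs_self M
    have := le_abs_self K2
    have := abs_nonneg M
    have := abs_nonneg K2
    nlinarith
  have hT0 : ∃ T0, xB T0 ≤ K1 := by
    refine ⟨max w (|M| + |K1|), ?_⟩
    rw [(b1 _ (le_max_left _ _)).1]
    have := (hM (max w (|M| + |K1|))).2
    have := le_max_right w (|M| + |K1|)
    have := le_abs_self M
    have := neg_abs_le K1
    have := abs_nonneg M
    have := abs_nonneg K1
    nlinarith
  obtain ⟨S0, hS0⟩ := hS0
  obtain ⟨T0, hT0⟩ := hT0
  have := o6_cross xA rA xB rB
    (by have := h1.cx; simp only [hxA]; fun_prop)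
    (by have := h1.cr; simp only [hrA]; fun_prop)
    (by have := h2.cx; simp only [hxB]; fun_prop)
    (by have := h2.cr; simp only [hrB]; fun_prop)
    (by
      intro s t hx hr
      rcases le_or_gt s v with hs | hs
      · rcases le_or_gt w t with ht | ht
        · rw [(a1 s hs).1, (b1 t ht).1] at hx
          rw [(a1 s hs).2, (b1 t ht).2] at hr
          have e : γ s = γ t := by
            have e1 := hpol s
            rw [hx, hr, ← hpol t] at e1
            exact sub_left_injective e1
          have f1 : γ (Int.fract s) = γ s := by
            rw [Int.fract]; simpa using hγper.sub_int_mul_eq ⌊s⌋ (x := s)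
          have f2 : γ (Int.fract t) = γ t := by
            rw [Int.fract]; simpa using hγper.sub_int_mul_eq ⌊t⌋ (x := t)
          have e3 : Int.fract s = Int.fract t :=
            hγinj ⟨Int.fract_nonneg _, Int.fract_lt_one _⟩ ⟨Int.fract_nonneg _, Int.fract_lt_one _⟩
              (by rw [f1, f2, e])
          obtain ⟨k, hk⟩ := Int.fract_eq_fract.1 e3
          have e4 := hper.sub_int_mul_eq k (x := s)
          rw [← hk, mul_one, sub_sub_cancel] at e4
          have e4 : θ t + 2 * Real.pi * t = θ s + 2 * Real.pi * s := e4
          nlinarith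
        · rw [(a1 s hs).1, (b2 t ht.le).1] at hx
          rw [(a1 s hs).2, (b2 t ht.le).2] at hr
          have e1 := hpol s
          rw [hx, hr, ← h2.pol] at e1
          exact h2.out (w - t) (by linarith) ⟨s, sub_left_injective e1⟩
      · rcases le_or_gt w t with ht | ht
        · rw [(a2 s hs.le).1, (b1 t ht).1] at hx
          rw [(a2 s hs.le).2, (b1 t ht).2] at hr
          have e1 := hpol t
          rw [← hx, ← hr, ← h1.pol] at e1
          exact h1.out (s - v) (by linarith) ⟨t, sub_left_injective e1⟩
        · rw [(a2 s hs.le).1, (b2 t ht.le).1] at hx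
          rw [(a2 s hs.le).2, (b2 t ht.le).2] at hr
          have e1 := h1.pol (s - v)
          rw [hx, hr, ← h2.pol] at e1
          exact hdis _ _ (sub_left_injective e1))
    S0 T0 (v + 1) (w - 1)
    (fun t => (hK2 t).trans_le hS0) (fun s => hT0.trans_lt (hK1 s))
    (fun t ht => by
      obtain ⟨hp, P, hP, hPe⟩ := T t
      rw [← ht, sA.1] at hPe
      rw [sA.2]
      exact o6_star C hC z _ P hz h1.fr hP _ _ _ (h1.rpos 1) hp (h1.pol 1) hPe)
    (fun s hs => by
      obtain ⟨hp, P, hP, hPe⟩ := S s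
      rw [hs, sB.1] at hPe
      rw [sB.2]
      exact o6_star C hC z _ P hz h2.fr hP _ _ _ (h2.rpos 1) hp (h2.pol 1) hPe)
  rwa [sA.1, sB.1] at this

/-- Existence of arms. -/
lemma o6_arm (C F : Set Pt) (γ : ℝ → Pt) (z : Pt) (ρ θ : ℝ → ℝ) (hC : IsContour C)
    (hF : IsCompact F) (hFC : F ⊆ interior C) (hγim : Set.range γ = frontier F)
    (hz : z ∈ interior F) (hρ : ∀ s, 0 < ρ s)
    (hpol : ∀ s, γ s - z = (ρ s * Real.cos (θ s), ρ s * Real.sin (θ s)))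
    (ℓ : Label) (hℓ : IsLabel C ℓ) (e : Pt)
    (hexit : e ∈ ℓ.leader ∩ Set.range γ ∧
      ∀ q ∈ ℓ.leader ∩ Set.range γ, dist e ℓ.port ≤ dist q ℓ.port)
    (v : ℝ) (hv : γ v = e) :
    ∃ x r σ, O6Arm C γ z ρ θ v x r σ ∧ (∀ t, σ t ∈ ℓ.leader) ∧ σ 1 = ℓ.port := by
  obtain ⟨⟨heL, heγ⟩, hmin⟩ := hexit
  have heF : e ∈ frontier F := hγim ▸ heγ
  have hep : e ≠ ℓ.port := by
    intro h
    exact hℓ.port_bd.2 (h ▸ hFC (hF.isClosed.frontier_subset heF))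
  have hpF : ℓ.port ∉ F := fun h => hℓ.port_bd.2 (hFC h)
  set c : ℝ → ℝ := fun t => max 0 (min t 1) with hc
  have hc0 : ∀ t, 0 ≤ c t := fun t => le_max_left _ _
  have hc1 : ∀ t, c t ≤ 1 := fun t => max_le zero_le_one (min_le_right _ _)
  have hcc : Continuous c := by simp only [hc]; fun_prop
  have hcid : ∀ t, 0 ≤ t → t ≤ 1 → c t = t := fun t h0 h1 => by
    simp only [hc]; rw [min_eq_left h1, max_eq_right h0]
  set σ : ℝ → Pt := fun t => e + c t • (ℓ.port - e) with hσ
  have hσc : Continuous σ := by simp only [hσ]; fun_prop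
  have hσe : ∀ t, σ (c t) = σ t := fun t => by
    simp only [hσ]; rw [hcid _ (hc0 t) (hc1 t)]
  have hσL : ∀ t, σ t ∈ ℓ.leader := by
    intro t
    have hpL : ℓ.port ∈ ℓ.leader := right_mem_segment ℝ _ _
    exact (convex_segment ℓ.site ℓ.port).add_smul_sub_mem heL hpL ⟨hc0 t, hc1 t⟩
  have hσ1 : σ 1 = ℓ.port := by
    simp only [hσ]; rw [hcid 1 zero_le_one le_rfl]; simp
  have hσ0 : σ 0 = e := by
    simp only [hσ]; rw [hcid 0 le_rfl zero_le_one]; simp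
  have hcpos : ∀ t, 0 < t → 0 < c t := fun t ht => lt_max_of_lt_right (lt_min ht one_pos)
  have hout : ∀ t, 0 < t → σ t ∉ Set.range γ := by
    intro t ht hr
    have h1 := hmin _ ⟨hσL t, hr⟩
    have h2 : σ t - ℓ.port = (1 - c t) • (e - ℓ.port) := by
      simp only [hσ]; module
    rw [dist_eq_norm, dist_eq_norm, h2, norm_smul, Real.norm_eq_abs,
      abs_of_nonneg (by linarith [hc1 t])] at h1
    have h3 : 0 < ‖e - ℓ.port‖ := norm_pos_iff.2 (sub_ne_zero.2 hep)
    nlinarith [hcpos t ht]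
  have hσz : ∀ t, σ t - z ≠ 0 := by
    intro t h
    have h : σ t = z := sub_eq_zero.1 h
    have htpos : 0 < t := by
      by_contra! hle
      have : c t = 0 := by
        simp only [hc]; exact max_eq_left ((min_le_left _ _).trans hle)
      have h2 : σ t = e := by simp only [hσ, this]; simp
      exact heF.2 (h2 ▸ h ▸ hz)
    have hpre : IsPreconnected (σ '' Set.Ioi 0) := isPreconnected_Ioi.image _ hσc.continuousOn
    have hsub : σ '' Set.Ioi 0 ⊆ interior F := by
      refine hpre.subset_left_of_subset_union isOpen_interior hF.isClosed.isOpen_compl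
        (disjoint_compl_right.mono_left interior_subset) ?_ ⟨z, ⟨t, htpos, h⟩, hz⟩
      rintro _ ⟨s, hs, rfl⟩
      by_cases hsF : σ s ∈ F
      · left
        by_contra hni
        exact hout s hs (hγim ▸ ⟨subset_closure hsF, hni⟩)
      · right; exact hsF
    exact hpF (interior_subset (hsub ⟨1, Set.mem_Ioi.2 one_pos, hσ1⟩))
  obtain ⟨x, r, hx, hr, hrp, hx0, hr0, hpl⟩ := o6_path (fun t => σ t - z) (by fun_prop) hσz
    (ρ v) (θ v) (hρ v) (by simp only [hσ0, ← hv, hpol])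
  have hc00 : c 0 = 0 := hcid 0 le_rfl zero_le_one
  refine ⟨x ∘ c, r ∘ c, σ, ⟨by fun_prop, by fun_prop, fun t => hrp _, by simp [hc00, hx0],
    by simp [hc00, hr0], fun t => hℓ.leader_in (hσL t), fun t => ?_, hout, hσ1 ▸ hℓ.port_bd, ?_⟩,
    hσL, hσ1⟩
  · have := hpl (c t)
    rw [hσe] at this
    exact this
  · obtain ⟨M, hM⟩ := (isCompact_Icc (a := (0 : ℝ)) (b := 1)).exists_bound_of_continuousOn
      (f := x) hx.continuousOn
    exact ⟨M, fun t => hM _ ⟨hc0 t, hc1 t⟩⟩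

lemma o6_left {C : Set Pt} {z p q : Pt} (hC : Convex ℝ C) (hz : z ∈ interior C)
    (hp : p ∈ frontier C) (hq : q ∈ C) (hpq : p ≠ q) (l : ℝ) (h0 : 0 ≤ l) (h1 : l ≤ 1)
    (hl : p.2 - z.2 = l * (q.2 - z.2)) :
    (p ∈ leftChain C → p.1 - z.1 < l * (q.1 - z.1)) ∧
    (p ∈ rightChain C → l * (q.1 - z.1) < p.1 - z.1) := by
  have hzC := interior_subset hz
  have hm : z + l • (q - z) ∈ C := hC.add_smul_sub_mem hzC hq ⟨h0, h1⟩
  have hm2 : (z + l • (q - z)).2 = p.2 := by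
    simp only [Prod.snd_add, Prod.smul_snd, Prod.snd_sub, smul_eq_mul]; linarith
  have hne : p.1 - z.1 ≠ l * (q.1 - z.1) := by
    intro h
    have hpm : p = z + l • (q - z) := by
      apply Prod.ext
      · simp only [Prod.fst_add, Prod.smul_fst, Prod.fst_sub, smul_eq_mul]; linarith
      · exact hm2.symm
    rcases h1.lt_or_eq with h1 | h1
    · have := hC.add_smul_sub_mem_interior hq hz (t := 1 - l) ⟨by linarith, by linarith⟩
      have e : q + (1 - l) • (z - q) = z + l • (q - z) := by module
      rw [e, ← hpm] at this
      exact hp.2 this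
    · apply hpq
      rw [hpm, h1]; simp
  constructor
  · intro h
    have := h.2.2 _ hm hm2
    simp only [Prod.fst_add, Prod.smul_fst, Prod.fst_sub, smul_eq_mul] at this
    exact lt_of_le_of_ne (by linarith) hne
  · intro h
    have := h.2.2 _ hm hm2
    simp only [Prod.fst_add, Prod.smul_fst, Prod.fst_sub, smul_eq_mul] at this
    exact lt_of_le_of_ne (by linarith) hne.symm

/-- Polar coordinates with principal angle. -/
def O6Pol (z p : Pt) (r k : ℝ) : Prop :=
  0 < r ∧ p - z = (r * Real.cos k, r * Real.sin k) ∧ -Real.pi < k ∧ k ≤ Real.pi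

lemma O6Pol.e1 {z p : Pt} {r k : ℝ} (h : O6Pol z p r k) : p.1 - z.1 = r * Real.cos k :=
  congrArg Prod.fst h.2.1

lemma O6Pol.e2 {z p : Pt} {r k : ℝ} (h : O6Pol z p r k) : p.2 - z.2 = r * Real.sin k :=
  congrArg Prod.snd h.2.1

lemma O6Pol.nonneg {z p : Pt} {r k : ℝ} (h : O6Pol z p r k) (hp : z.2 ≤ p.2) : 0 ≤ k := by
  by_contra! hk
  have := Real.sin_neg_of_neg_of_neg_pi_lt hk h.2.2.1
  have := h.e2
  nlinarith [h.1]

lemma O6Pol.neg {z p : Pt} {r k : ℝ} (h : O6Pol z p r k) (hp : p.2 < z.2) : k < 0 := by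
  by_contra! hk
  have := Real.sin_nonneg_of_nonneg_of_le_pi hk h.2.2.2
  have := h.e2
  nlinarith [h.1]

lemma o6_cmp {z p q : Pt} {r k r' k' : ℝ} (h : O6Pol z p r k) (h' : O6Pol z q r' k')
    (hs : (z.2 ≤ p.2 ∧ z.2 ≤ q.2) ∨ (p.2 < z.2 ∧ q.2 < z.2))
    (hX : 0 < (q.1 - z.1) * (p.2 - z.2) - (q.2 - z.2) * (p.1 - z.1)) : k' < k := by
  by_contra! hle
  have hd : k' - k ≤ Real.pi := by
    rcases hs with ⟨h1, h2⟩ | ⟨h1, h2⟩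
    · linarith [h.nonneg h1, h'.2.2.2]
    · linarith [h'.neg h2, h.2.2.1]
  have h3 := Real.sin_nonneg_of_nonneg_of_le_pi (sub_nonneg.2 hle) hd
  rw [Real.sin_sub] at h3
  rw [h.e1, h.e2, h'.e1, h'.e2] at hX
  have h4 := mul_nonneg (mul_pos h.1 h'.1).le h3
  nlinarith

/-- comparison for the chains, upper half. -/
lemma o6_up {C : Set Pt} {z p q : Pt} {r k r' k' : ℝ} (hC : Convex ℝ C) (hz : z ∈ interior C)
    (h : O6Pol z p r k) (h' : O6Pol z q r' k')
    (hp : p ∈ frontier C) (hq : q ∈ C) (hpq : p ≠ q) (h1 : z.2 ≤ p.2) (h2 : p.2 ≤ q.2)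
    (h3 : z.2 < q.2) : (p ∈ leftChain C → k' < k) ∧ (p ∈ rightChain C → k < k') := by
  have hb : 0 < q.2 - z.2 := by linarith
  have hl := o6_left hC hz hp hq hpq ((p.2 - z.2) / (q.2 - z.2))
    (div_nonneg (by linarith) hb.le) (by rw [div_le_one hb]; linarith)
    (by field_simp)
  have e : (p.2 - z.2) / (q.2 - z.2) * (q.2 - z.2) = p.2 - z.2 := by field_simp
  set l := (p.2 - z.2) / (q.2 - z.2)
  constructor
  · intro hc
    have := mul_lt_mul_of_pos_left (hl.1 hc) hb
    exact o6_cmp h h' (Or.inl ⟨h1, h3.le⟩) (by rw [← e]; nlinarith)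
  · intro hc
    have := mul_lt_mul_of_pos_left (hl.2 hc) hb
    exact o6_cmp h' h (Or.inl ⟨h3.le, h1⟩) (by rw [← e]; nlinarith)

lemma o6_down {C : Set Pt} {z p q : Pt} {r k r' k' : ℝ} (hC : Convex ℝ C) (hz : z ∈ interior C)
    (h : O6Pol z p r k) (h' : O6Pol z q r' k')
    (hp : p ∈ frontier C) (hq : q ∈ C) (hpq : p ≠ q) (h1 : p.2 < z.2) (h2 : q.2 ≤ p.2) :
    (p ∈ leftChain C → k < k') ∧ (p ∈ rightChain C → k' < k) := by
  have hb : 0 < z.2 - q.2 := by linarith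
  have hl := o6_left hC hz hp hq hpq ((z.2 - p.2) / (z.2 - q.2))
    (div_nonneg (by linarith) hb.le) (by rw [div_le_one hb]; linarith)
    (by field_simp; ring)
  have e : (z.2 - p.2) / (z.2 - q.2) * (z.2 - q.2) = z.2 - p.2 := by field_simp
  set l := (z.2 - p.2) / (z.2 - q.2)
  have e' : p.2 - z.2 = l * (q.2 - z.2) := by linarith
  constructor
  · intro hc
    have := mul_lt_mul_of_pos_left (hl.1 hc) hb
    exact o6_cmp h' h (Or.inr ⟨by linarith, h1⟩) (by rw [e']; nlinarith)
  · intro hc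
    have := mul_lt_mul_of_pos_left (hl.2 hc) hb
    exact o6_cmp h h' (Or.inr ⟨h1, by linarith⟩) (by rw [e']; nlinarith)

def O6U (C : Set Pt) (z p : Pt) : Prop := p ∈ leftChain C ∧ p ∉ rightChain C ∧ z.2 ≤ p.2

lemma o6_claim2 {C : Set Pt} {z p q : Pt} {r k r' k' : ℝ} (hC : Convex ℝ C) (hz : z ∈ interior C)
    (h : O6Pol z p r k) (h' : O6Pol z q r' k') (hp : O6U C z p) (hq : ¬ O6U C z q)
    (hqc : q ∈ leftChain C ∨ q ∈ rightChain C) : k' < k := by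
  obtain ⟨hpl, hpr, hpz⟩ := hp
  rcases lt_or_ge q.2 z.2 with hqz | hqz
  · exact (h'.neg hqz).trans_le (h.nonneg hpz)
  have hqr : q ∈ rightChain C := by
    by_contra hn
    exact hq ⟨hqc.resolve_right hn, hn, hqz⟩
  have hne : p ≠ q := fun e => hpr (e ▸ hqr)
  rcases le_or_gt p.2 q.2 with hle | hlt
  · rcases hqz.lt_or_eq with hqz' | hqz'
    · exact (o6_up hC hz h h' hpl.2.1 hqr.1 hne hpz hle hqz').1 hpl
    · have hpz' : p.2 = z.2 := by linarith
      have hzC := interior_subset hz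
      have c1 := hpl.2.2 z hzC hpz'.symm
      have c2 := hqr.2.2 z hzC hqz'
      have d1 : p.1 ≠ z.1 := fun e => hpl.2.1.2 (by rwa [show p = z from Prod.ext e hpz'])
      have d2 : q.1 ≠ z.1 := fun e => hqr.2.1.2 (by rwa [show q = z from Prod.ext e hqz'.symm])
      have c1 := lt_of_le_of_ne c1 d1
      have c2 := lt_of_le_of_ne c2 d2.symm
      have f1 := h.e1
      have f2 := h'.e1
      have hpi := Real.pi_pos
      have g1 : Real.pi / 2 < k := by
        by_contra! hk
        have := Real.cos_nonneg_of_neg_pi_div_two_le_of_le (by linarith [h.nonneg hpz]) hk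
        nlinarith [h.1]
      have g2 : k' < Real.pi / 2 := by
        by_contra! hk
        have := Real.cos_nonpos_of_pi_div_two_le_of_le hk (by linarith [h'.2.2.2])
        nlinarith [h'.1]
      linarith
  · exact (o6_up hC hz h' h hqr.2.1 hpl.1 hne.symm hqz hlt.le (by linarith)).2 hqr

lemma o6_claim1 {C : Set Pt} {z p q : Pt} {r k r' k' : ℝ} (hC : Convex ℝ C) (hz : z ∈ interior C)
    (h : O6Pol z p r k) (h' : O6Pol z q r' k') (hpq : CwLT C p q)
    (hU : O6U C z p ↔ O6U C z q) : k' < k := by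
  rcases hpq with ⟨hp, hq, hlt⟩ | ⟨hp, hq, hq'⟩ | ⟨hp', hp, hq, hq', hlt⟩
  · have hne : p ≠ q := fun e => by rw [e] at hlt; exact lt_irrefl _ hlt
    rcases le_or_gt z.2 q.2 with hqz | hqz
    · exact (o6_up hC hz h' h hq.2.1 hp.1 hne.symm hqz hlt.le (by linarith)).2 hq
    · rcases le_or_gt z.2 p.2 with hpz | hpz
      · exact (h'.neg hqz).trans_le (h.nonneg hpz)
      · exact (o6_down hC hz h h' hp.2.1 hq.1 hne hpz hlt.le).2 hp
  · have hne : p ≠ q := fun e => hq' (e ▸ hp)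
    have hqz : q.2 < z.2 := by
      by_contra! hc
      exact (hU.2 ⟨hq, hq', hc⟩).2.1 hp
    rcases le_or_gt z.2 p.2 with hpz | hpz
    · exact (h'.neg hqz).trans_le (h.nonneg hpz)
    · rcases le_total q.2 p.2 with hle | hle
      · exact (o6_down hC hz h h' hp.2.1 hq.1 hne hpz hle).2 hp
      · exact (o6_down hC hz h' h hq.2.1 hp.1 hne.symm hqz hle).1 hq
  · have hne : p ≠ q := fun e => by rw [e] at hlt; exact lt_irrefl _ hlt
    rcases le_or_gt z.2 p.2 with hpz | hpz
    · exact (o6_up hC hz h h' hp.2.1 hq.1 hne hpz hlt.le (by linarith)).1 hp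
    · have hqz : q.2 < z.2 := by
        by_contra! hc
        linarith [(hU.2 ⟨hq, hq', hc⟩).2.2]
      exact (o6_down hC hz h' h hq.2.1 hp.1 hne.symm hqz hlt.le).1 hq

lemma o6_U_mono {C : Set Pt} {z p q : Pt} (hpq : CwLT C p q) (hU : O6U C z p) : O6U C z q := by
  rcases hpq with ⟨hp, hq, hlt⟩ | ⟨hp, hq, hq'⟩ | ⟨hp', hp, hq, hq', hlt⟩
  · exact (hU.2.1 hp).elim
  · exact (hU.2.1 hp).elim
  · exact ⟨hq, hq', hU.2.2.trans hlt.le⟩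

lemma CwLT.chain1 {C : Set Pt} {p q : Pt} (h : CwLT C p q) : p ∈ leftChain C ∨ p ∈ rightChain C := by
  rcases h with h | h | h
  · exact Or.inr h.1
  · exact Or.inr h.1
  · exact Or.inl h.2.1

lemma o6_trans {C : Set Pt} {p q r : Pt} (h : CwLT C p q) (h' : CwLT C q r) : CwLT C p r := by
  rcases h with ⟨a, b, c⟩ | ⟨a, b, c⟩ | ⟨a, b, c, d, e⟩ <;>
  rcases h' with ⟨a', b', c'⟩ | ⟨a', b', c'⟩ | ⟨a', b', c', d', e'⟩
  · exact Or.inl ⟨a, b', c'.trans c⟩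
  · exact Or.inr (Or.inl ⟨a, b', c'⟩)
  · exact (a' b).elim
  · exact (c a').elim
  · exact (c a').elim
  · exact Or.inr (Or.inl ⟨a, c', d'⟩)
  · exact (d a').elim
  · exact (d a').elim
  · exact Or.inr (Or.inr ⟨a, b, c', d', e.trans e'⟩)

lemma o6_kcyc {C : Set Pt} {z p q s : Pt} {r1 k1 r2 k2 r3 k3 : ℝ} (hC : Convex ℝ C)
    (hz : z ∈ interior C) (h1 : O6Pol z p r1 k1) (h2 : O6Pol z q r2 k2) (h3 : O6Pol z s r3 k3)
    (hpq : CwLT C p q) (hqs : CwLT C q s) :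
    (k2 < k1 ∧ k3 < k2) ∨ (k2 < k1 ∧ k1 < k3) ∨ (k3 < k2 ∧ k1 < k3) := by
  have hps := o6_trans hpq hqs
  by_cases up : O6U C z p
  · have uq := o6_U_mono hpq up
    have us := o6_U_mono hqs uq
    exact Or.inl ⟨o6_claim1 hC hz h1 h2 hpq (by tauto), o6_claim1 hC hz h2 h3 hqs (by tauto)⟩
  by_cases us : O6U C z s
  · have a := o6_claim2 hC hz h3 h1 us up hpq.chain1
    by_cases uq : O6U C z q
    · exact Or.inr (Or.inr ⟨o6_claim1 hC hz h2 h3 hqs (by tauto), a⟩)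
    · exact Or.inr (Or.inl ⟨o6_claim1 hC hz h1 h2 hpq (by tauto), a⟩)
  · have uq : ¬ O6U C z q := fun h => us (o6_U_mono hqs h)
    exact Or.inl ⟨o6_claim1 hC hz h1 h2 hpq (by tauto), o6_claim1 hC hz h2 h3 hqs (by tauto)⟩

lemma o6_princ {z p : Pt} {r f : ℝ} (hr : 0 < r)
    (h : p - z = (r * Real.cos f, r * Real.sin f)) :
    ∃ n : ℤ, O6Pol z p r (f + n * (2 * Real.pi)) := by
  obtain ⟨n, hn, -⟩ := existsUnique_add_zsmul_mem_Ioc Real.two_pi_pos f (-Real.pi)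
  rw [zsmul_eq_mul] at hn
  refine ⟨n, hr, ?_, hn.1, by linarith [hn.2]⟩
  rw [Real.cos_add_int_mul_two_pi, Real.sin_add_int_mul_two_pi, h]

lemma o6_int {m n : ℤ} {a b f g : ℝ} (ha : a = f + m * (2 * Real.pi))
    (hb : b = g + n * (2 * Real.pi)) (ha1 : -Real.pi < a) (ha2 : a ≤ Real.pi)
    (hb1 : -Real.pi < b) (hb2 : b ≤ Real.pi) (h1 : g < f) (h2 : f < g + 2 * Real.pi) :
    m = n ∨ m = n - 1 := by
  have hpi := Real.pi_pos
  have l1 : m < n + 1 := by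
    by_contra! hc
    have : (n : ℝ) + 1 ≤ m := by exact_mod_cast hc
    nlinarith
  have l2 : n - 2 < m := by
    by_contra! hc
    have : (m : ℝ) ≤ n - 2 := by exact_mod_cast hc
    nlinarith
  omega

lemma o6_cyc {C : Set Pt} {z p q s : Pt} {r1 f1 r2 f2 r3 f3 : ℝ} (hC : Convex ℝ C)
    (hz : z ∈ interior C) (p1 : 0 < r1) (p2 : 0 < r2) (p3 : 0 < r3)
    (h1 : p - z = (r1 * Real.cos f1, r1 * Real.sin f1))
    (h2 : q - z = (r2 * Real.cos f2, r2 * Real.sin f2))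
    (h3 : s - z = (r3 * Real.cos f3, r3 * Real.sin f3))
    (hpq : CwLT C p q) (hqs : CwLT C q s)
    (o1 : f3 < f1) (o2 : f2 < f3) (o3 : f1 - 2 * Real.pi < f2) : False := by
  obtain ⟨a, ha⟩ := o6_princ p1 h1
  obtain ⟨b, hb⟩ := o6_princ p2 h2
  obtain ⟨c, hc⟩ := o6_princ p3 h3
  have hk := o6_kcyc hC hz ha hb hc hpq hqs
  have i1 := o6_int rfl rfl ha.2.2.1 ha.2.2.2 hc.2.2.1 hc.2.2.2 o1 (by linarith)
  have i2 := o6_int rfl rfl hc.2.2.1 hc.2.2.2 hb.2.2.1 hb.2.2.2 o2 (by linarith)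
  have i3 := o6_int rfl rfl ha.2.2.1 ha.2.2.2 hb.2.2.1 hb.2.2.2 (by linarith) (by linarith)
  have hpi := Real.pi_pos
  rcases i1 with i1 | i1 <;> rcases i2 with i2 | i2
  · subst i1; subst i2
    rcases hk with ⟨x, y⟩ | ⟨x, y⟩ | ⟨x, y⟩ <;> linarith
  · subst i1; subst i2
    push_cast at hk
    rcases hk with ⟨x, y⟩ | ⟨x, y⟩ | ⟨x, y⟩ <;> linarith
  · subst i1; subst i2
    push_cast at hk
    rcases hk with ⟨x, y⟩ | ⟨x, y⟩ | ⟨x, y⟩ <;> linarith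
  · omega

/-- Observation 1, generalized. In a planar contour labeling
whose leaders all cross a Jordan curve `γ` bounding a figure `F` containing all
sites, the ports along `∂C` (clockwise) and the exit points along `γ`
(clockwise) induce the same cyclic ordering of the labels: some rotation of the
radially ordered list has strictly increasing exit parameters. -/
theorem statement_6
    (C : Set Pt) (t : Pt) (S : Finset Pt) (L : List Label)
    (F : Set Pt) (γ : ℝ → Pt) (z : Pt)
    (e : Label → Pt) (u : Label → ℝ)
    (hC : IsContour C) (ht : IsTopmost C t) (hgen : GenPos S)
    (hF : IsCompact F) (hFC : F ⊆ interior C)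
    (hγcont : Continuous γ) (hγper : Function.Periodic γ 1)
    (hγinj : Set.InjOn γ (Set.Ico (0 : ℝ) 1))
    (hγim : Set.range γ = frontier F)
    (hz : z ∈ interior F)
    (hcw : ClockwiseJordan γ z)
    (hsites : ∀ s ∈ S, s ∈ interior F)
    (hlab : IsContourLabeling C S L)
    (hplanar : PlanarList L)
    (hcross : ∀ ℓ ∈ L, (ℓ.leader ∩ Set.range γ).Nonempty)
    (hexit : ∀ ℓ ∈ L, e ℓ ∈ ℓ.leader ∩ Set.range γ ∧
      ∀ q ∈ ℓ.leader ∩ Set.range γ, dist (e ℓ) ℓ.port ≤ dist q ℓ.port)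
    (hu : ∀ ℓ ∈ L, u ℓ ∈ Set.Ico (0 : ℝ) 1 ∧ γ (u ℓ) = e ℓ) :
    ∃ j : ℕ, ((L.rotate j).map u).Chain' (· < ·) := by
  classical
  obtain ⟨ρ, θ, hρc, hθc, hρ, hpol, hθ⟩ := hcw
  have hzC : z ∈ interior C := hFC (interior_subset hz)
  have hγC : ∀ s, γ s ∈ C := fun s => interior_subset
    (hFC (hF.isClosed.frontier_subset (hγim ▸ Set.mem_range_self s)))
  have hρper : ∀ s, ρ (s + 1) = ρ s := by
    intro s
    have h1 := hpol (s + 1)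
    rw [hγper s, hpol s, hθ, Real.cos_sub_two_pi, Real.sin_sub_two_pi] at h1
    exact (o6_polar_inj h1).symm
  have harm : ∀ ℓ ∈ L, ∃ x r σ, O6Arm C γ z ρ θ (u ℓ) x r σ ∧ (∀ t, σ t ∈ ℓ.leader) ∧
      σ 1 = ℓ.port := fun ℓ hℓ =>
    o6_arm C F γ z ρ θ hC hF hFC hγim hz hρ hpol ℓ (hlab.valid ℓ hℓ) (e ℓ) (hexit ℓ hℓ)
      (u ℓ) (hu ℓ hℓ).2
  -- disjointness of leaders
  have hdis : ∀ a b : Label, a.toSet ∩ b.toSet = ∅ → ∀ q, q ∈ a.leader → q ∈ b.leader → False := by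
    intro a b h q ha hb
    have : q ∈ a.toSet ∩ b.toSet := ⟨Or.inr ha, Or.inr hb⟩
    rw [h] at this
    exact this
  have hne : ∀ a ∈ L, ∀ b ∈ L, a.toSet ∩ b.toSet = ∅ → u a ≠ u b := by
    intro a ha b hb h hab
    have h1 := (hexit a ha).1.1
    have h2 := (hexit b hb).1.1
    rw [← (hu a ha).2, hab, (hu b hb).2] at h1
    exact hdis a b h _ h1 h2
  -- the main comparison
  have key : ∀ l ∈ L, ∀ a ∈ L, ∀ b ∈ L, a.toSet ∩ b.toSet = ∅ → l.toSet ∩ a.toSet = ∅ →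
      l.toSet ∩ b.toSet = ∅ → u l ≤ u a → u l ≤ u b →
      ((CwLT C l.port a.port ∧ CwLT C a.port b.port) ∨
       (CwLT C b.port l.port ∧ CwLT C l.port a.port) ∨
       (CwLT C a.port b.port ∧ CwLT C b.port l.port)) → u a < u b := by
    intro l hl a ha b hb dab dla dlb _ ulb hcyc
    by_contra! hle
    have hlt : u b < u a := lt_of_le_of_ne hle (hne a ha b hb dab).symm
    have hlb : u l < u b := lt_of_le_of_ne ulb (hne l hl b hb dlb)
    have hal : u a < u l + 1 := by
      have := (hu a ha).1.2
      have := (hu l hl).1.1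
      linarith
    obtain ⟨x0, r0, σ0, A0, m0, e0⟩ := harm l hl
    obtain ⟨x1, r1, σ1, A1, m1, e1⟩ := harm a ha
    obtain ⟨x2, r2, σ2, A2, m2, e2⟩ := harm b hb
    have k1 : x2 1 < x0 1 := o6_key hC.convex hzC hγper hγinj hγC hρc hθc hρ hpol hθ A0 A2
      (fun s t h => hdis l b dlb _ (m0 s) (h ▸ m2 t)) hlb
    have k2 : x1 1 < x2 1 := o6_key hC.convex hzC hγper hγinj hγC hρc hθc hρ hpol hθ A2 A1
      (fun s t h => hdis a b dab _ (m1 t) (h ▸ m2 s)) hlt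
    have k3 : x0 1 - 2 * Real.pi < x1 1 :=
      o6_key hC.convex hzC hγper hγinj hγC hρc hθc hρ hpol hθ A1 (A0.shift hθ hρper)
      (fun s t h => hdis l a dla _ (m0 t) (h ▸ m1 s)) hal
    have q0 := A0.pol 1
    have q0' := (A0.shift hθ hρper).pol 1
    have q1 := A1.pol 1
    have q2 := A2.pol 1
    rw [e0] at q0 q0'
    rw [e1] at q1
    rw [e2] at q2
    rcases hcyc with ⟨c1, c2⟩ | ⟨c1, c2⟩ | ⟨c1, c2⟩
    · exact o6_cyc hC.convex hzC (A0.rpos 1) (A1.rpos 1) (A2.rpos 1) q0 q1 q2 c1 c2 k1 k2 k3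
    · exact o6_cyc hC.convex hzC (A2.rpos 1) (A0.rpos 1) (A1.rpos 1) q2 q0' q1 c1 c2 k2 k3
        (by linarith)
    · exact o6_cyc hC.convex hzC (A1.rpos 1) (A2.rpos 1) (A0.rpos 1) q1
        (f2 := x2 1 - 2 * Real.pi) (by simpa using q2) q0' c1 c2 k3 (by linarith) (by linarith)
  rcases L.eq_nil_or_concat with hnil | hcons
  · refine ⟨0, List.Pairwise.isChain ?_⟩
    simp [hnil]
  have hne' : L.toFinset.Nonempty := by
    obtain ⟨X, y, h⟩ := hcons
    exact ⟨y, by simp [h]⟩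
  obtain ⟨l, hl, hmin⟩ := L.toFinset.exists_min_image u hne'
  simp only [List.mem_toFinset] at hl hmin
  haveI : IsTrans Label (fun a b : Label => CwLT C a.port b.port) :=
    ⟨fun a b c h h' => o6_trans h h'⟩
  have hpw : L.Pairwise (fun a b : Label => CwLT C a.port b.port) :=
    List.isChain_iff_pairwise.1 hlab.radial
  have hpw2 : L.Pairwise (fun a b : Label => CwLT C a.port b.port ∧ a.toSet ∩ b.toSet = ∅) :=
    hpw.and hplanar
  obtain ⟨X, Y, hXY⟩ := List.append_of_mem hl
  refine ⟨X.length, ?_⟩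
  apply List.Pairwise.isChain
  have hrot : L.rotate X.length = l :: (Y ++ X) := by
    rw [hXY, List.rotate_append_length_eq]; rfl
  rw [hrot, List.pairwise_map, List.pairwise_cons, List.pairwise_append]
  rw [hXY, List.pairwise_append, List.pairwise_cons] at hpw2
  obtain ⟨pX, ⟨plY, pY⟩, pXl⟩ := hpw2
  have hXL : ∀ a ∈ X, a ∈ L := fun a ha => by rw [hXY]; simp [ha]
  have hYL : ∀ a ∈ Y, a ∈ L := fun a ha => by rw [hXY]; simp [ha]
  have dX : ∀ a ∈ X, CwLT C a.port l.port ∧ l.toSet ∩ a.toSet = ∅ := fun a ha => by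
    have := pXl a ha l (by simp)
    exact ⟨this.1, by rw [Set.inter_comm]; exact this.2⟩
  refine ⟨?_, ?_, ?_, ?_⟩
  · intro b hb
    rcases List.mem_append.1 hb with hb | hb
    · exact lt_of_le_of_ne (hmin b (hYL b hb)) (hne l hl b (hYL b hb) (plY b hb).2)
    · exact lt_of_le_of_ne (hmin b (hXL b hb)) (hne l hl b (hXL b hb) (dX b hb).2)
  · refine pY.imp_of_mem ?_
    intro a b ha hb hab
    exact key l hl a (hYL a ha) b (hYL b hb) hab.2 (plY a ha).2 (plY b hb).2
      (hmin a (hYL a ha)) (hmin b (hYL b hb)) (Or.inl ⟨(plY a ha).1, hab.1⟩)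
  · refine pX.imp_of_mem ?_
    intro a b ha hb hab
    exact key l hl a (hXL a ha) b (hXL b hb) hab.2 (dX a ha).2 (dX b hb).2
      (hmin a (hXL a ha)) (hmin b (hXL b hb)) (Or.inr (Or.inr ⟨hab.1, (dX b hb).1⟩))
  · intro a ha b hb
    have hba := pXl b hb a (by simp [ha])
    exact key l hl a (hYL a ha) b (hXL b hb) (by rw [Set.inter_comm]; exact hba.2) (plY a ha).2
      (dX b hb).2 (hmin a (hYL a ha)) (hmin b (hXL b hb)) (Or.inr (Or.inl ⟨(dX b hb).1, (plY a ha).1⟩))
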